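/- For any partitions μ, ν, π one has the identity of polynomials in the variable v: ∑_κ g^κ_{μ,ν}(α) θ_{κ/π}^{(α)}(v) = ∑_{ρ,ξ} g^π_{ρ,ξ}(α) θ_{μ/ρ}^{(α)}(v) θ_{ν/ξ}^{(α)}(v), where the sums run over all partitions κ, respectively over all pairs of partitions (ρ,ξ) (only finitely many terms are nonzero). -/

import Mathlib

open scoped Classical

noncomputable section

/-- The base field `ℚ(α)` of rational functions in the Jack parameter `α`. -/
abbrev F : Type := RatFunc ℚ

/-- The Jack deformation parameter `α`. -/
def alpha : F := RatFunc.X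

/-- An integer partition, encoded as a multiset of positive integers (its parts). -/
abbrev JPartition : Type := Multiset ℕ+

/-- The size `|λ|` of a partition. -/
def psize (l : JPartition) : ℕ := (l.map fun i => (i : ℕ)).sum

/-- The length `ℓ(λ)` of a partition. -/
def plen (l : JPartition) : ℕ := Multiset.card l

/-- `m_i(λ)`, the number of parts of `λ` equal to `i`. -/
def pmult (l : JPartition) (i : ℕ+) : ℕ := Multiset.count i l

/-- `λ ∪ 1^k`, adjoining `k` parts equal to `1`. -/
def addOnes (l : JPartition) (k : ℕ) : JPartition := l + Multiset.replicate k 1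

/-- `λ̃`, the partition obtained by deleting all parts equal to `1`. -/
def removeOnes (l : JPartition) : JPartition := Multiset.filter (fun i => i ≠ 1) l

/-- Exponent vectors of monomials in the power-sum generators `p₁, p₂, …`. -/
abbrev Exp : Type := ℕ+ →₀ ℕ

/-- The exponent vector of the monomial `p_λ`. -/
def toExp (l : JPartition) : Exp := l.toFinset.sum fun i => Finsupp.single i (Multiset.count i l)

/-- The partition corresponding to an exponent vector. -/
def toPart (m : Exp) : JPartition := m.sum fun i k => Multiset.replicate k i

/-- The weighted degree (`deg p_i = i`) of an exponent vector; this is the size of the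
corresponding partition. -/
def wt (m : Exp) : ℕ := m.sum fun i k => k * (i : ℕ)

/-- The algebra `ℚ(α)[p₁, p₂, …]` of symmetric functions written in the power-sum basis. -/
abbrev SymA : Type := MvPolynomial ℕ+ F

/-- The power-sum monomial `p_λ`. -/
def pPow (l : JPartition) : SymA := (l.map fun i => MvPolynomial.X i).prod

/-- `z_λ α^{ℓ(λ)}`, attached to the exponent vector of `p_λ`. -/
def zalpha (m : Exp) : F :=
  algebraMap ℚ F (m.prod fun i k => (Nat.factorial k : ℚ) * ((i : ℕ) : ℚ) ^ k) *
    alpha ^ (m.sum fun _ k => k)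

/-- The `α`-deformed Hall scalar product: `⟨p_λ, p_μ⟩ = δ_{λμ} z_λ α^{ℓ(λ)}`. -/
def hall (f g : SymA) : F :=
  ∑ m ∈ f.support, MvPolynomial.coeff m f * MvPolynomial.coeff m g * zalpha m

/-- The parts of a partition, sorted in weakly decreasing order. -/
def sortedParts (l : JPartition) : List ℕ := ((l.map fun i => (i : ℕ)).sort (· ≤ ·)).reverse

/-- The sum of the `k` largest parts of a partition. -/
def topSum (l : JPartition) (k : ℕ) : ℕ := ((sortedParts l).take k).sum

/-- The dominance order on partitions: `μ ⊴ λ`. -/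
def dominates (mu lam : JPartition) : Prop :=
  psize mu = psize lam ∧ ∀ k, topSum mu k ≤ topSum lam k

/-- Evaluation of a symmetric function (in power-sum coordinates) in `N` variables
`x₁, …, x_N`: it sends `p_i ↦ x₁^i + ⋯ + x_N^i`. -/
def evalN (N : ℕ) : SymA →ₐ[F] MvPolynomial (Fin N) F :=
  MvPolynomial.aeval fun i : ℕ+ => ∑ j : Fin N, MvPolynomial.X j ^ (i : ℕ)

/-- The exponent of the monomial `x₁^{μ₁} ⋯ x_s^{μ_s}` in `N` variables, for `μ` a
partition; its coefficient in a symmetric polynomial is the coefficient of the monomial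
symmetric function `m_μ` (provided `N ≥ ℓ(μ)`). -/
def xexp (mu : JPartition) (N : ℕ) : Fin N →₀ ℕ :=
  Finsupp.equivFunOnFinite.symm fun j => (sortedParts mu).getD (j : ℕ) 0

/-- The defining properties of the family of Jack polynomials `J_λ^{(α)}` (Macdonald's
characterization): orthogonality for the `α`-deformed Hall product, triangularity with
respect to monomial symmetric functions in dominance order, and normalization
`[p_{1^n}] J_λ^{(α)} = 1`. -/
structure IsJackFamily (J : JPartition → SymA) : Prop where
  orthogonal : ∀ l m : JPartition, l ≠ m → hall (J l) (J m) = 0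
  triangular : ∀ l m : JPartition, ¬ dominates m l →
    MvPolynomial.coeff (xexp m (psize l + psize m + plen m))
      (evalN (psize l + psize m + plen m) (J l)) = 0
  normalized : ∀ l : JPartition, MvPolynomial.coeff (Finsupp.single 1 (psize l)) (J l) = 1

/-- The Jack character `θ_μ^{(α)}(λ)`. -/
def theta (J : JPartition → SymA) (mu lam : JPartition) : F :=
  if psize lam < psize mu then 0
  else (Nat.choose (psize lam - psize mu + pmult mu 1) (pmult mu 1) : F) *
    MvPolynomial.coeff (toExp (addOnes mu (psize lam - psize mu))) (J lam)

/-- `g` is the family of structure coefficients of Jack characters: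
`θ_μ^{(α)} θ_ν^{(α)} = ∑_π g^π_{μ,ν}(α) θ_π^{(α)}` (as functions on Young diagrams,
with finitely many nonzero terms). -/
def IsStructCoeffs (J : JPartition → SymA) (g : JPartition → JPartition → JPartition → F) :
    Prop :=
  (∀ mu nu : JPartition, {pi : JPartition | g pi mu nu ≠ 0}.Finite) ∧
  ∀ mu nu lam : JPartition,
    theta J mu lam * theta J nu lam = ∑ᶠ pi : JPartition, g pi mu nu * theta J pi lam


/-- `Th μ ν` is the family of skew Jack characters `θ_{μ/ν}^{(α)}(v)` (polynomials in the
single variable `v`), defined by the expansion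
`θ_μ^{(α)}(v, u₁, u₂, …) = ∑_ν θ_{μ/ν}^{(α)}(v) θ_ν^{(α)}(u₁, u₂, …)`.
Since shifted symmetric functions are determined by their values on partitions, this is
characterized by: for every partition `λ` and every `v ∈ ℕ₊` at least as large as all
parts of `λ` (so that `(v, λ₁, λ₂, …)` is again a partition),
`θ_μ^{(α)}(v ::ₘ λ) = ∑_ν θ_{μ/ν}^{(α)}(v) θ_ν^{(α)}(λ)`, with finitely many nonzero
summands. -/
def IsSkewTheta (J : JPartition → SymA)
    (Th : JPartition → JPartition → Polynomial F) : Prop :=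
  (∀ mu : JPartition, {nu : JPartition | Th mu nu ≠ 0}.Finite) ∧
  ∀ (mu lam : JPartition) (v : ℕ+), (∀ i ∈ lam, i ≤ v) →
    theta J mu (v ::ₘ lam) =
      ∑ᶠ nu : JPartition, Polynomial.eval (((v : ℕ) : F)) (Th mu nu) * theta J nu lam

/-! ### Power sums and monomial coefficients -/

/-- The multiset of nonzero values of an exponent vector. -/
def nzvals {N : ℕ} (e : Fin N →₀ ℕ) : Multiset ℕ := e.support.val.map e

/-- Product of power sums with natural number coefficients. -/
def psN (N : ℕ) (s : JPartition) : MvPolynomial (Fin N) ℕ :=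
  (s.map fun i : ℕ+ => ∑ j : Fin N, MvPolynomial.X j ^ (i : ℕ)).prod

theorem psN_cons (N : ℕ) (i : ℕ+) (s : JPartition) :
    psN N (i ::ₘ s) = (∑ j : Fin N, MvPolynomial.X j ^ (i : ℕ)) * psN N s := by
  simp [psN]

theorem nzvals_add_single {N : ℕ} (e : Fin N →₀ ℕ) (j : Fin N) (i : ℕ) (hi : i ≠ 0)
    (hj : e j = 0) : nzvals (e + Finsupp.single j i) = i ::ₘ nzvals e := by
  have hjs : j ∉ e.support := by simpa using hj
  have h1 : (e + Finsupp.single j i).support = Finset.cons j e.support hjs := by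
    ext k
    by_cases hk : k = j
    · subst hk; simp [hi]
    · simp [hk, Finsupp.single_apply, Ne.symm hk]
  unfold nzvals
  rw [h1, Finset.cons_val, Multiset.map_cons]
  congr 1
  · simp [hj]
  · apply Multiset.map_congr rfl
    intro k hk
    have : j ≠ k := by rintro rfl; exact hjs hk
    simp [Finsupp.single_apply, this]

theorem card_nzvals_add_single {N : ℕ} (e : Fin N →₀ ℕ) (j : Fin N) (i : ℕ)
    (hj : e j ≠ 0) : Multiset.card (nzvals (e + Finsupp.single j i)) =
      Multiset.card (nzvals e) := by
  have h1 : (e + Finsupp.single j i).support = e.support := by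
    ext k
    by_cases hk : k = j
    · subst hk; simp [hj]
    · simp [Finsupp.single_apply, Ne.symm hk]
  simp [nzvals, h1]

theorem psN_coeff_upper (N : ℕ) (s : JPartition) : ∀ e : Fin N →₀ ℕ,
    MvPolynomial.coeff e (psN N s) ≠ 0 →
      Multiset.card (nzvals e) ≤ Multiset.card s ∧
      (Multiset.card (nzvals e) = Multiset.card s → nzvals e = s.map fun i : ℕ+ => (i : ℕ)) := by
  induction s using Multiset.induction with
  | empty =>
    intro e he
    have : e = 0 := by
      by_contra h
      apply he
      simp [psN, MvPolynomial.coeff_one, Ne.symm h]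
    subst this
    simp [nzvals]
  | cons i s ih =>
    intro e he
    rw [psN_cons, Finset.sum_mul, MvPolynomial.coeff_sum] at he
    obtain ⟨j, -, hj⟩ := Finset.exists_ne_zero_of_sum_ne_zero he
    rw [MvPolynomial.X_pow_eq_monomial, MvPolynomial.coeff_monomial_mul'] at hj
    split_ifs at hj with hle
    · rw [one_mul] at hj
      obtain ⟨h1, h2⟩ := ih _ hj
      have hee : e = (e - Finsupp.single j (i : ℕ)) + Finsupp.single j (i : ℕ) :=
        (tsub_add_cancel_of_le hle).symm
      set e' := e - Finsupp.single j (i : ℕ) with he'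
      rw [hee]
      by_cases h0 : e' j = 0
      · rw [nzvals_add_single e' j i i.ne_zero h0]
        simp only [Multiset.card_cons, Multiset.map_cons]
        refine ⟨by omega, fun h => ?_⟩
        rw [h2 (by omega)]
      · rw [card_nzvals_add_single e' j i h0, Multiset.card_cons]
        exact ⟨by omega, fun h => by omega⟩
    · exact absurd rfl hj

theorem sum_nzvals {N : ℕ} (e : Fin N →₀ ℕ) : (nzvals e).sum = ∑ j, e j := by
  have : (nzvals e).sum = ∑ j ∈ e.support, e j := rfl
  rw [this]
  apply Finset.sum_subset (Finset.subset_univ _)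
  intro j _ hj
  simpa using hj

theorem psN_coeff_sum (N : ℕ) (s : JPartition) : ∀ e : Fin N →₀ ℕ,
    MvPolynomial.coeff e (psN N s) ≠ 0 → (nzvals e).sum = psize s := by
  induction s using Multiset.induction with
  | empty =>
    intro e he
    have : e = 0 := by
      by_contra h
      apply he
      simp [psN, MvPolynomial.coeff_one, Ne.symm h]
    subst this
    simp [nzvals, psize]
  | cons i s ih =>
    intro e he
    rw [psN_cons, Finset.sum_mul, MvPolynomial.coeff_sum] at he
    obtain ⟨j, -, hj⟩ := Finset.exists_ne_zero_of_sum_ne_zero he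
    rw [MvPolynomial.X_pow_eq_monomial, MvPolynomial.coeff_monomial_mul'] at hj
    split_ifs at hj with hle
    · rw [one_mul] at hj
      have h1 := ih _ hj
      have hee : e = (e - Finsupp.single j (i : ℕ)) + Finsupp.single j (i : ℕ) :=
        (tsub_add_cancel_of_le hle).symm
      set e' := e - Finsupp.single j (i : ℕ) with he'
      rw [sum_nzvals] at h1 ⊢
      rw [hee]
      simp only [Finsupp.add_apply, Finset.sum_add_distrib, h1]
      simp [psize, Finsupp.single_apply, add_comm]
    · exact absurd rfl hj

theorem psN_coeff_lower (N : ℕ) (s : JPartition) : ∀ e : Fin N →₀ ℕ,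
    nzvals e = (s.map fun i : ℕ+ => (i : ℕ)) → MvPolynomial.coeff e (psN N s) ≠ 0 := by
  induction s using Multiset.induction with
  | empty =>
    intro e he
    have : e = 0 := by simpa [nzvals] using he
    subst this
    simp [psN]
  | cons i s ih =>
    intro e he
    have hmem : (i : ℕ) ∈ nzvals e := by rw [he]; simp
    obtain ⟨j, hj, hji⟩ := Multiset.mem_map.1 hmem
    have hee : e = e.erase j + Finsupp.single j (i : ℕ) := by
      rw [← hji]; exact (Finsupp.erase_add_single j e).symm
    have h0 : (e.erase j) j = 0 := by simp
    have hv : nzvals (e.erase j) = s.map fun i : ℕ+ => (i : ℕ) := by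
      have := nzvals_add_single (e.erase j) j i i.ne_zero h0
      rw [← hee, he, Multiset.map_cons] at this
      exact ((Multiset.cons_inj_right _).1 this).symm
    have h1 := ih _ hv
    rw [psN_cons, Finset.sum_mul, MvPolynomial.coeff_sum]
    intro hz
    rw [Finset.sum_eq_zero_iff] at hz
    have := hz j (Finset.mem_univ j)
    rw [MvPolynomial.X_pow_eq_monomial, hee, add_comm, MvPolynomial.coeff_monomial_mul,
      one_mul] at this
    exact h1 this

theorem evalN_monomial (N : ℕ) (m : Exp) (c : F) :
    evalN N (MvPolynomial.monomial m c) =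
      MvPolynomial.C c * MvPolynomial.map (Nat.castRingHom F) (psN N (Finsupp.toMultiset m)) := by
  rw [evalN, MvPolynomial.aeval_monomial]
  congr 1
  rw [psN, map_multiset_prod, Multiset.map_map, Finsupp.toMultiset_map, Finsupp.prod_toMultiset]
  rw [Finsupp.prod_mapDomain_index]
  · apply Finsupp.prod_congr
    intro x _
    simp
  · simp
  · intros; rw [pow_add]

theorem coeff_evalN (N : ℕ) (f : SymA) (e : Fin N →₀ ℕ) :
    MvPolynomial.coeff e (evalN N f) = ∑ m ∈ f.support, MvPolynomial.coeff m f *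
      ((MvPolynomial.coeff e (psN N (Finsupp.toMultiset m)) : ℕ) : F) := by
  conv_lhs => rw [f.as_sum]
  rw [map_sum, MvPolynomial.coeff_sum]
  apply Finset.sum_congr rfl
  intro m _
  rw [evalN_monomial, MvPolynomial.coeff_C_mul, MvPolynomial.coeff_map]
  rfl

theorem psize_eq (l : JPartition) : psize l = (l.map fun i : ℕ+ => (i : ℕ)).sum := by
  simp [psize, Multiset.bind_def, Multiset.pure_def, Multiset.bind_singleton]

theorem coe_sortedParts (l : JPartition) :
    ((sortedParts l : List ℕ) : Multiset ℕ) = l.map fun i : ℕ+ => (i : ℕ) := by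
  unfold sortedParts
  rw [Multiset.coe_reverse, Multiset.sort_eq]
  simp [Multiset.bind_def, Multiset.pure_def, Multiset.bind_singleton]

theorem nzvals_eq_filter {N : ℕ} (e : Fin N →₀ ℕ) :
    nzvals e = Multiset.filter (fun k => k ≠ 0) (Multiset.ofList (List.ofFn e)) := by
  have h1 : Multiset.ofList (List.ofFn e) = (Finset.univ : Finset (Fin N)).val.map e := by
    rw [Fin.univ_val_map]
  rw [h1, Multiset.filter_map, nzvals]
  congr 1
  have : e.support = Finset.univ.filter (fun k => e k ≠ 0) := by ext; simp
  rw [this]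
  rfl

theorem nzvals_xexp (l : JPartition) (N : ℕ) (hN : plen l ≤ N) :
    nzvals (xexp l N) = l.map fun i : ℕ+ => (i : ℕ) := by
  have hlen : (sortedParts l).length = plen l := by
    have := congrArg Multiset.card (coe_sortedParts l)
    simpa [plen] using this
  have h1 : List.ofFn (xexp l N) =
      sortedParts l ++ List.replicate (N - (sortedParts l).length) 0 := by
    apply List.ext_getElem
    · simp; omega
    · intro k h1 h2
      simp only [List.getElem_ofFn, xexp, Finsupp.equivFunOnFinite_symm_apply_apply]
      rw [List.getElem_append]
      split_ifs with h
      · simp [h]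
      · simp at h
        simp [h]
  rw [nzvals_eq_filter, h1, ← Multiset.coe_add, Multiset.filter_add, coe_sortedParts]
  have h2 : Multiset.filter (fun k => k ≠ 0)
      (Multiset.ofList (List.replicate (N - (sortedParts l).length) 0)) = 0 := by
    rw [Multiset.filter_eq_nil]
    intro a ha
    have := List.eq_of_mem_replicate (Multiset.mem_coe.1 ha)
    simp [this]
  rw [h2, add_zero, Multiset.filter_eq_self]
  intro a ha
  obtain ⟨i, -, rfl⟩ := Multiset.mem_map.1 ha
  exact i.ne_zero

theorem map_coe_inj {s t : JPartition}
    (h : (s.map fun i : ℕ+ => (i : ℕ)) = t.map fun i : ℕ+ => (i : ℕ)) : s = t :=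
  Multiset.map_injective PNat.coe_injective h

/-- Jack polynomials are homogeneous. -/
theorem jack_homog {J : JPartition → SymA} (hJ : IsJackFamily J) (l : JPartition) (m : Exp)
    (hm : MvPolynomial.coeff m (J l) ≠ 0) : psize (Finsupp.toMultiset m) = psize l := by
  by_contra hne
  let B := (J l).support.filter fun m => psize (Finsupp.toMultiset m) ≠ psize l
  have hB : B.Nonempty := ⟨m, by simp [B, hm, hne]⟩
  obtain ⟨b, hb, hmax⟩ := B.exists_max_image (fun m => Multiset.card (Finsupp.toMultiset m)) hB
  simp only [B, Finset.mem_filter, MvPolynomial.mem_support_iff] at hb hmax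
  have ht := hJ.triangular l (Finsupp.toMultiset b) (fun h => hb.2 h.1)
  set N := psize l + psize (Finsupp.toMultiset b) + plen (Finsupp.toMultiset b) with hN
  have hv : nzvals (xexp (Finsupp.toMultiset b) N) = (Finsupp.toMultiset b).map fun i : ℕ+ => (i : ℕ) :=
    nzvals_xexp _ _ (by omega)
  rw [coeff_evalN, Finset.sum_eq_single b] at ht
  · have h1 := psN_coeff_lower N _ _ hv
    rcases mul_eq_zero.1 ht with h | h
    · exact hb.1 h
    · exact h1 (by exact_mod_cast h)
  · intro c hc hcb
    by_contra hz
    have hz2 : MvPolynomial.coeff (xexp (Finsupp.toMultiset b) N)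
        (psN N (Finsupp.toMultiset c)) ≠ 0 := by
      intro h; apply hz; rw [h]; simp
    obtain ⟨h1, h2⟩ := psN_coeff_upper N _ _ hz2
    have h3 := psN_coeff_sum N _ _ hz2
    rw [hv] at h1 h2 h3
    rw [Multiset.card_map] at h1 h2
    have h4 := hmax c ⟨by simpa using hc, by rw [← h3, ← psize_eq]; exact hb.2⟩
    have h5 := map_coe_inj (h2 (le_antisymm h1 h4))
    exact hcb (Multiset.toFinsupp.symm.injective h5).symm
  · intro h
    exact absurd (by simpa using hb.1) h

theorem toExp_eq (l : JPartition) : toExp l = Multiset.toFinsupp l := by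
  ext i
  simp only [toExp, Finsupp.finsetSum_apply, Finsupp.single_apply, Finset.sum_ite_eq',
    Multiset.mem_toFinset, Multiset.toFinsupp_apply]
  split_ifs with h
  · rfl
  · exact (Multiset.count_eq_zero_of_notMem h).symm

/-! ### Definiteness of the Hall product -/

theorem sum_sq_ne_zero {ι : Type*} (s : Finset ι) (c : ι → F) (q : ι → ℚ) (k : ι → ℕ)
    (hq : ∀ i ∈ s, 0 < q i)
    (h : ∑ i ∈ s, c i * c i * (algebraMap ℚ F (q i) * alpha ^ k i) = 0) :
    ∀ i ∈ s, c i = 0 := by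
  obtain ⟨b, hb⟩ := IsLocalization.exist_integer_multiples (nonZeroDivisors (Polynomial ℚ)) s c
  have hb' : ∀ i, ∃ a : Polynomial ℚ, i ∈ s →
      algebraMap (Polynomial ℚ) F a = algebraMap (Polynomial ℚ) F b * c i := by
    intro i
    by_cases hi : i ∈ s
    · obtain ⟨a, ha⟩ := hb i hi
      refine ⟨a, fun _ => ?_⟩
      rw [ha, Algebra.smul_def]
    · exact ⟨0, fun h => absurd h hi⟩
  choose a ha using hb'
  have hinj : Function.Injective (algebraMap (Polynomial ℚ) F) :=
    IsFractionRing.injective (Polynomial ℚ) F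
  have hb0 : algebraMap (Polynomial ℚ) F b ≠ 0 := by
    intro h0
    exact nonZeroDivisors.coe_ne_zero b (hinj (by rw [h0, map_zero]))
  have hpoly : ∑ i ∈ s, a i * a i * (Polynomial.C (q i) * Polynomial.X ^ k i) = 0 := by
    apply hinj
    rw [map_zero, map_sum]
    have : ∀ i ∈ s, algebraMap (Polynomial ℚ) F
        (a i * a i * (Polynomial.C (q i) * Polynomial.X ^ k i)) =
        (algebraMap (Polynomial ℚ) F b * algebraMap (Polynomial ℚ) F b) *
          (c i * c i * (algebraMap ℚ F (q i) * alpha ^ k i)) := by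
      intro i hi
      simp only [map_mul, map_pow, ha i hi]
      have h1 : algebraMap (Polynomial ℚ) F (Polynomial.C (q i)) = algebraMap ℚ F (q i) := by
        
        exact RingHom.congr_fun (Subsingleton.elim
          ((algebraMap (Polynomial ℚ) F).comp Polynomial.C) (algebraMap ℚ F)) (q i)
      have h2 : algebraMap (Polynomial ℚ) F Polynomial.X = alpha := RatFunc.algebraMap_X
      rw [h1, h2]
      ring
    rw [Finset.sum_congr rfl this, ← Finset.mul_sum, h, mul_zero]
  have hzero : ∀ i ∈ s, a i = 0 := by
    intro i hi
    apply Polynomial.eq_zero_of_infinite_isRoot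
    apply Set.Infinite.mono _ (Set.Ioi_infinite (0 : ℚ))
    intro x hx
    have hx' : 0 < x := hx
    have he := congrArg (Polynomial.eval x) hpoly
    rw [Polynomial.eval_finsetSum, Polynomial.eval_zero, Finset.sum_eq_zero_iff_of_nonneg] at he
    · have h1 := he i hi
      simp only [Polynomial.eval_mul, Polynomial.eval_C, Polynomial.eval_pow,
        Polynomial.eval_X] at h1
      have h2 : q i * x ^ k i ≠ 0 := (mul_pos (hq i hi) (pow_pos hx' _)).ne'
      have h3 := (mul_eq_zero.1 h1).resolve_right h2
      exact mul_self_eq_zero.1 h3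
    · intro j hj
      simp only [Polynomial.eval_mul, Polynomial.eval_C, Polynomial.eval_pow,
        Polynomial.eval_X]
      exact mul_nonneg (mul_self_nonneg _) (mul_pos (hq j hj) (pow_pos hx' _)).le
  intro i hi
  have := ha i hi
  rw [hzero i hi, map_zero] at this
  exact (mul_eq_zero.1 this.symm).resolve_left hb0

theorem hall_self_ne_zero (f : SymA) (hf : f ≠ 0) : hall f f ≠ 0 := by
  intro h
  apply hf
  have := sum_sq_ne_zero f.support (fun m => MvPolynomial.coeff m f)
    (fun m => m.prod fun i k => (Nat.factorial k : ℚ) * ((i : ℕ) : ℚ) ^ k)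
    (fun m => m.sum fun _ k => k) (by
      intro m _
      apply Finset.prod_pos
      intro i _
      have : (0 : ℚ) < ((i : ℕ) : ℚ) := by exact_mod_cast i.pos
      positivity) h
  ext m
  by_cases hm : m ∈ f.support
  · simpa using this m hm
  · simpa using hm

/-! ### Linear independence of Jack characters -/

/-- Partitions of size `n`. -/
abbrev PartOf (n : ℕ) : Type := {s : JPartition // psize s = n}

instance finitePartOf (n : ℕ) : Finite (PartOf n) := by
  let f : PartOf n → Nat.Partition n := fun s =>
    { parts := s.1.map fun i : ℕ+ => (i : ℕ)
      parts_pos := by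
        intro i hi
        obtain ⟨j, -, rfl⟩ := Multiset.mem_map.1 hi
        exact j.pos
      parts_sum := by rw [← psize_eq]; exact s.2 }
  apply Finite.of_injective f
  intro s t h
  exact Subtype.ext (map_coe_inj (congrArg Nat.Partition.parts h))

instance fintypePartOf (n : ℕ) : Fintype (PartOf n) := Fintype.ofFinite _

theorem hall_eq_sum {J : JPartition → SymA} (hJ : IsJackFamily J) (n : ℕ) (l : PartOf n)
    (f : SymA) :
    hall (J l.1) f = ∑ s : PartOf n, MvPolynomial.coeff (Multiset.toFinsupp s.1) (J l.1) *
      MvPolynomial.coeff (Multiset.toFinsupp s.1) f * zalpha (Multiset.toFinsupp s.1) := by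
  rw [hall]
  symm
  apply Finset.sum_bij_ne_zero (fun (s : PartOf n) _ _ => Multiset.toFinsupp s.1)
  · intro s _ hs
    rw [MvPolynomial.mem_support_iff]
    intro h; apply hs; rw [h]; simp
  · intro s _ _ t _ _ h
    exact Subtype.ext (Multiset.toFinsupp.injective h)
  · intro m hm hne
    have hh := jack_homog hJ l.1 m (by simpa using hm)
    refine ⟨⟨Finsupp.toMultiset m, hh.trans l.2⟩, Finset.mem_univ _, ?_, ?_⟩
    · simpa using hne
    · simp
  · intros; rfl

theorem jack_ne_zero {J : JPartition → SymA} (hJ : IsJackFamily J) (l : JPartition) :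
    J l ≠ 0 := by
  intro h
  have := hJ.normalized l
  rw [h] at this
  simp at this

theorem jack_matrix {J : JPartition → SymA} (hJ : IsJackFamily J) (n : ℕ) (c : PartOf n → F)
    (hc : ∀ l : PartOf n, ∑ s : PartOf n,
      MvPolynomial.coeff (Multiset.toFinsupp s.1) (J l.1) * c s = 0) : c = 0 := by
  let A : Matrix (PartOf n) (PartOf n) F := fun l s =>
    MvPolynomial.coeff (Multiset.toFinsupp s.1) (J l.1)
  let B : Matrix (PartOf n) (PartOf n) F := fun s l =>
    MvPolynomial.coeff (Multiset.toFinsupp s.1) (J l.1) * zalpha (Multiset.toFinsupp s.1) *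
      (hall (J l.1) (J l.1))⁻¹
  have hAB : A * B = 1 := by
    ext l k
    rw [Matrix.mul_apply]
    have : ∑ j, A l j * B j k = hall (J l.1) (J k.1) * (hall (J k.1) (J k.1))⁻¹ := by
      rw [hall_eq_sum hJ n l, Finset.sum_mul]
      apply Finset.sum_congr rfl
      intro s _
      simp only [A, B]
      ring
    rw [this, Matrix.one_apply]
    split_ifs with h
    · subst h
      exact mul_inv_cancel₀ (hall_self_ne_zero _ (jack_ne_zero hJ _))
    · rw [hJ.orthogonal _ _ (fun h' => h (Subtype.ext h')), zero_mul]
  have hBA : B * A = 1 := mul_eq_one_comm.1 hAB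
  have hAc : A.mulVec c = 0 := by
    ext l
    exact hc l
  calc c = (B * A).mulVec c := by rw [hBA, Matrix.one_mulVec]
    _ = 0 := by rw [← Matrix.mulVec_mulVec, hAc, Matrix.mulVec_zero]

theorem theta_same {J : JPartition → SymA} (mu lam : JPartition) (h : psize mu = psize lam) :
    theta J mu lam = MvPolynomial.coeff (Multiset.toFinsupp mu) (J lam) := by
  simp [theta, h, addOnes, toExp_eq]

theorem theta_indep {J : JPartition → SymA} (hJ : IsJackFamily J) (S : Finset JPartition)
    (c : JPartition → F) (h : ∀ lam, ∑ s ∈ S, c s * theta J s lam = 0) :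
    ∀ s ∈ S, c s = 0 := by
  have key : ∀ n, ∀ s ∈ S, psize s = n → c s = 0 := by
    intro n
    induction n using Nat.strong_induction_on with
    | _ n ih =>
      have hm := jack_matrix hJ n (fun s => if s.1 ∈ S then c s.1 else 0) (by
        intro l
        refine Eq.trans ?_ (h l.1)
        apply Finset.sum_bij_ne_zero (fun (s : PartOf n) _ _ => s.1)
        · intro s _ hs
          by_contra hS
          apply hs
          simp [hS]
        · intro s _ _ t _ _ hst
          exact Subtype.ext hst
        · intro s hs hne
          have hsn : psize s = n := by
            rcases lt_trichotomy (psize s) n with h1 | h1 | h1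
            · exact absurd (by rw [ih _ h1 s hs rfl, zero_mul]) hne
            · exact h1
            · exact absurd (by rw [theta, if_pos (by rw [l.2]; exact h1), mul_zero]) hne
          refine ⟨⟨s, hsn⟩, Finset.mem_univ _, ?_, rfl⟩
          rw [theta_same _ _ (hsn.trans l.2.symm)] at hne
          simp only [hs, if_true]
          rwa [mul_comm]
        · intro s _ hs
          have hS : s.1 ∈ S := by
            by_contra hS
            apply hs
            simp [hS]
          rw [theta_same _ _ (s.2.trans l.2.symm)]
          simp only [hS, if_true]
          rw [mul_comm])
      intro s hs hsn
      have := congrFun hm ⟨s, hsn⟩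
      simpa [hs] using this
  intro s hs
  exact key _ s hs rfl

theorem theta_indep_poly {J : JPartition → SymA} (hJ : IsJackFamily J) (S : Finset JPartition)
    (E : JPartition → Polynomial F)
    (h : ∀ lam, ∑ s ∈ S, E s * Polynomial.C (theta J s lam) = 0) :
    ∀ s ∈ S, E s = 0 := by
  intro s hs
  ext k
  rw [Polynomial.coeff_zero]
  refine theta_indep hJ S (fun s => (E s).coeff k) (fun lam => ?_) s hs
  have := congrArg (fun p => Polynomial.coeff p k) (h lam)
  simpa [Polynomial.finsetSum_coeff] using this


/-- **Lemma 4.3.** For any partitions `μ, ν, π`: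
`∑_κ g^κ_{μ,ν} θ_{κ/π}^{(α)}(v) = ∑_{ρ,ξ} g^π_{ρ,ξ} θ_{μ/ρ}^{(α)}(v) θ_{ν/ξ}^{(α)}(v)`,
an identity of polynomials in `v`. -/
theorem statement8
    (J : JPartition → SymA) (hJ : IsJackFamily J)
    (g : JPartition → JPartition → JPartition → F) (hg : IsStructCoeffs J g)
    (Th : JPartition → JPartition → Polynomial F) (hTh : IsSkewTheta J Th)
    (mu nu pi : JPartition) :
    (∑ᶠ kappa : JPartition, g kappa mu nu • Th kappa pi)
      = ∑ᶠ rho : JPartition, ∑ᶠ xi : JPartition, g pi rho xi • (Th mu rho * Th nu xi) := by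
  obtain ⟨hgf, hgm⟩ := hg
  obtain ⟨hTf, hTm⟩ := hTh
  set K := (hgf mu nu).toFinset with hK
  set R := (hTf mu).toFinset with hR
  set X := (hTf nu).toFinset with hX
  let S : Finset JPartition := {pi} ∪ (K.biUnion fun k => (hTf k).toFinset) ∪
    ((R ×ˢ X).biUnion fun q => (hgf q.1 q.2).toFinset)
  let E : JPartition → Polynomial F := fun p =>
    (∑ k ∈ K, g k mu nu • Th k p) - ∑ r ∈ R, ∑ x ∈ X, g p r x • (Th mu r * Th nu x)
  have hgS : ∀ (m n lam : JPartition) (T : Finset JPartition), (hgf m n).toFinset ⊆ T →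
      theta J m lam * theta J n lam = ∑ p ∈ T, g p m n * theta J p lam := by
    intro m n lam T hT
    rw [hgm, finsum_eq_sum_of_support_subset]
    intro p hp
    apply hT
    simp only [Set.Finite.mem_toFinset, Set.mem_ofPred_eq]
    exact left_ne_zero_of_mul hp
  have hTS : ∀ (m lam : JPartition) (v : ℕ+) (T : Finset JPartition), (hTf m).toFinset ⊆ T →
      (∀ i ∈ lam, i ≤ v) → theta J m (v ::ₘ lam) =
        ∑ p ∈ T, Polynomial.eval (((v : ℕ) : F)) (Th m p) * theta J p lam := by
    intro m lam v T hT hv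
    rw [hTm m lam v hv, finsum_eq_sum_of_support_subset]
    intro p hp
    apply hT
    simp only [Set.Finite.mem_toFinset, Set.mem_ofPred_eq]
    intro h0
    apply left_ne_zero_of_mul hp
    rw [h0, Polynomial.eval_zero]
  have hSpi : pi ∈ S := by simp [S]
  have hE : E pi = 0 := by
    refine theta_indep_poly hJ S E (fun lam => ?_) pi hSpi
    apply Polynomial.eq_zero_of_infinite_isRoot
    let M : ℕ := psize lam + 1
    have hinf : (Set.range fun k : ℕ => ((k + M : ℕ) : F)).Infinite := by
      apply Set.infinite_range_of_injective
      intro a b hab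
      have : a + M = b + M := Nat.cast_injective (R := F) hab
      omega
    apply hinf.mono
    rintro _ ⟨k, rfl⟩
    let v : ℕ+ := ⟨k + M, by omega⟩
    have hv : ∀ i ∈ lam, i ≤ v := by
      intro i hi
      have h1 : (i : ℕ) ≤ psize lam := by
        rw [psize_eq]
        exact Multiset.single_le_sum (by simp) _ (Multiset.mem_map_of_mem _ hi)
      rw [← PNat.coe_le_coe]
      show (i : ℕ) ≤ k + M
      omega
    have hvv : ((k + M : ℕ) : F) = ((v : ℕ) : F) := rfl
    show Polynomial.eval ((k + M : ℕ) : F) _ = 0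
    rw [hvv]
    have e1 : theta J mu (v ::ₘ lam) * theta J nu (v ::ₘ lam) =
        ∑ p ∈ S, (∑ k ∈ K, g k mu nu * Polynomial.eval ((v : ℕ) : F) (Th k p)) *
          theta J p lam := by
      rw [hgS mu nu _ K subset_rfl]
      simp only [Finset.sum_mul]
      rw [Finset.sum_comm]
      apply Finset.sum_congr rfl
      intro k hk
      rw [hTS k lam v S _ hv, Finset.mul_sum]
      · simp only [mul_assoc]
      · intro p hp
        simp only [S, Finset.mem_union, Finset.mem_biUnion]
        exact Or.inl (Or.inr ⟨k, hk, hp⟩)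
    have e2 : theta J mu (v ::ₘ lam) * theta J nu (v ::ₘ lam) =
        ∑ p ∈ S, (∑ r ∈ R, ∑ x ∈ X, g p r x * (Polynomial.eval ((v : ℕ) : F) (Th mu r) *
          Polynomial.eval ((v : ℕ) : F) (Th nu x))) * theta J p lam := by
      rw [hTS mu lam v R subset_rfl hv, hTS nu lam v X subset_rfl hv]
      simp only [Finset.sum_mul]
      rw [Finset.sum_comm]
      apply Finset.sum_congr rfl
      intro r hr
      rw [Finset.sum_comm, Finset.mul_sum]
      apply Finset.sum_congr rfl
      intro x hx
      have hgx := hgS r x lam S (by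
        intro p hp
        simp only [S, Finset.mem_union, Finset.mem_biUnion]
        exact Or.inr ⟨(r, x), Finset.mem_product.2 ⟨hr, hx⟩, hp⟩)
      rw [mul_mul_mul_comm, hgx, Finset.mul_sum]
      apply Finset.sum_congr rfl
      intro p _
      ring
    simp only [E, Polynomial.eval_finsetSum, Polynomial.eval_mul, Polynomial.eval_sub,
      Polynomial.eval_smul, Polynomial.eval_C, smul_eq_mul, sub_mul, Finset.sum_sub_distrib]
    rw [← e1, ← e2, sub_self]
  have hL : (∑ᶠ kappa : JPartition, g kappa mu nu • Th kappa pi) =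
      ∑ k ∈ K, g k mu nu • Th k pi := by
    apply finsum_eq_sum_of_support_subset
    intro p hp
    simp only [hK, Finset.mem_coe, Set.Finite.mem_toFinset, Set.mem_ofPred_eq]
    intro h0
    apply hp
    simp [h0]
  have hRr : (∑ᶠ rho : JPartition, ∑ᶠ xi : JPartition, g pi rho xi • (Th mu rho * Th nu xi)) =
      ∑ r ∈ R, ∑ x ∈ X, g pi r x • (Th mu r * Th nu x) := by
    rw [finsum_eq_sum_of_support_subset (s := R)]
    · apply Finset.sum_congr rfl
      intro r _
      apply finsum_eq_sum_of_support_subset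
      intro p hp
      simp only [hX, Finset.mem_coe, Set.Finite.mem_toFinset, Set.mem_ofPred_eq]
      intro h0
      apply hp
      simp [h0]
    · intro p hp
      simp only [hR, Finset.mem_coe, Set.Finite.mem_toFinset, Set.mem_ofPred_eq]
      intro h0
      apply hp
      simp [h0]
  rw [hL, hRr]
  exact sub_eq_zero.1 hE

end
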